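/- arXiv:1903.10759 — 8 statements merged into one kernel-verified Lean document; each statement's English description precedes it below -/
import Mathlib

section
/- Let R, D, E : ℝ → Mₙ(ℂ) with R differentiable and R(θ) invertible for all θ, and let Γ : ℝ → Mₙ(ℂ) satisfy the parallel condition R'(θ) = −Γ(θ)·R(θ). Suppose the intertwining relation D(θ)·R(θ) = R(θ)·E(θ) holds for all θ, and that there is a scalar function c : ℝ → ℂ with D'(θ) = c(θ)·D(θ) and E'(θ) = c(θ)·E(θ) for all θ. Then D(θ) commutes with Γ(θ) for all θ: [D(θ), Γ(θ)] = 0. -/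
attribute [local instance] Matrix.normedAddCommGroup Matrix.normedSpace

/-- The product rule for matrix-valued functions of a real variable. -/
theorem HasDerivAt.matrix_mul_fin {n : ℕ} {A B : ℝ → Matrix (Fin n) (Fin n) ℂ}
    {A' B' : Matrix (Fin n) (Fin n) ℂ} {t : ℝ}
    (hA : HasDerivAt A A' t) (hB : HasDerivAt B B' t) :
    HasDerivAt (fun s => A s * B s) (A' * B t + A t * B') t := by
  have entry {M : ℝ → Matrix (Fin n) (Fin n) ℂ} {M' : Matrix (Fin n) (Fin n) ℂ}
      (h : HasDerivAt M M' t) (i j : Fin n) : HasDerivAt (fun s => M s i j) (M' i j) t :=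
    hasDerivAt_pi.1 (hasDerivAt_pi.1 h i) j
  refine hasDerivAt_pi.2 fun i => hasDerivAt_pi.2 fun j => ?_
  simp only [Matrix.add_apply, Matrix.mul_apply, ← Finset.sum_add_distrib]
  exact HasDerivAt.fun_sum fun k _ => (entry hA i k).mul (entry hB k j)

/-- Algebra invariance `D θ * R θ = R θ * E θ` for an `R`-matrix satisfying the parallel
condition `R' = -Γ R`, together with the special coproduct property `D' = c D`, `E' = c E`,
implies that `D θ` commutes with the connection `Γ θ`. -/
theorem coproduct_commutes_with_connection {n : ℕ}
    (R D E Γ : ℝ → Matrix (Fin n) (Fin n) ℂ) (c : ℝ → ℂ)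
    (hinv : ∀ θ : ℝ, IsUnit (R θ))
    (hpar : ∀ θ : ℝ, HasDerivAt R (-(Γ θ * R θ)) θ)
    (hintertwine : ∀ θ : ℝ, D θ * R θ = R θ * E θ)
    (hD : ∀ θ : ℝ, HasDerivAt D (c θ • D θ) θ)
    (hE : ∀ θ : ℝ, HasDerivAt E (c θ • E θ) θ) :
    ∀ θ : ℝ, D θ * Γ θ - Γ θ * D θ = 0 := by
  intro θ
  have hDR := (hD θ).matrix_mul_fin (hpar θ)
  have hRE := (hpar θ).matrix_mul_fin (hE θ)
  rw [funext hintertwine] at hDR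
  have key := hDR.unique hRE
  rw [smul_mul_assoc, mul_smul_comm, ← hintertwine θ, neg_mul, mul_neg, mul_assoc (Γ θ),
    ← hintertwine θ, add_comm, add_left_inj, neg_inj, ← mul_assoc, ← mul_assoc] at key
  exact sub_eq_zero.2 ((hinv θ).mul_right_cancel key)
end

section
/- Let α ≠ 0 be real and, for (p₁, p₂) ∈ (0,π)², let R(p₁,p₂) be the 4×4 matrix with nonzero entries R₁₁ = 1, R₁₄ = α^{-2}·T^{1/2}, R₂₂ = 1, R₂₃ = R₃₂ = T^{1/2}, R₃₃ = −1, R₄₁ = α²·T^{1/2}, R₄₄ = −1, where T = tan(p₁/4)/tan(p₂/4). Then every entry E of R satisfies the boost-annihilation equation sin(p₁/2)·∂E/∂p₁ + sin(p₂/2)·∂E/∂p₂ = 0 on (0,π)². Equivalently, in the variables γᵢ = log(tan(pᵢ/4)), one has (∂/∂γ₁ + ∂/∂γ₂)R = 0, so R depends only on γ₁ − γ₂. -/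
open Real

/-- The massless right-right R-matrix of the `AdS₂ × S² × T⁶` superstring (upper sign),
with `T = tan (p₁/4) / tan (p₂/4)`. -/
noncomputable def RmatrixAdS2 (α p₁ p₂ : ℝ) : Matrix (Fin 4) (Fin 4) ℝ :=
  let T : ℝ := Real.sqrt (Real.tan (p₁ / 4) / Real.tan (p₂ / 4))
  !![1, 0, 0, α⁻¹ ^ 2 * T;
     0, 1, T, 0;
     0, T, -1, 0;
     α ^ 2 * T, 0, 0, -1]

/-- On `(0, π)` both `cos (p / 4)` and `tan (p / 4)` are positive. -/
theorem cos_tan_quarter_pos {p : ℝ} (h : p ∈ Set.Ioo 0 π) :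
    0 < Real.cos (p / 4) ∧ 0 < Real.tan (p / 4) := by
  obtain ⟨h0, hπ⟩ := h
  exact ⟨Real.cos_pos_of_mem_Ioo ⟨by linarith, by linarith⟩,
    Real.tan_pos_of_pos_of_lt_pi_div_two (by linarith) (by linarith)⟩

/-- The boost vector field `sin (p / 2) d/dp` acts on `tan (p / 4)` as multiplication by `1 / 2`. -/
theorem sin_half_mul_deriv_tan_quarter {p : ℝ} (hc : Real.cos (p / 4) ≠ 0) :
    Real.sin (p / 2) * (1 / Real.cos (p / 4) ^ 2 * (1 / 4)) = Real.tan (p / 4) / 2 := by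
  rw [show p / 2 = 2 * (p / 4) by ring, Real.sin_two_mul, Real.tan_eq_sin_div_cos]
  field_simp
  norm_num

theorem hasDerivAt_tan_quarter {p : ℝ} (hc : Real.cos (p / 4) ≠ 0) :
    HasDerivAt (fun x : ℝ => Real.tan (x / 4)) (1 / Real.cos (p / 4) ^ 2 * (1 / 4)) p :=
  (Real.hasDerivAt_tan hc).comp (h := fun x : ℝ => x / 4) p ((hasDerivAt_id' p).div_const 4)

/-- The square root of `tan (p₁ / 4) / tan (p₂ / 4)` is differentiable on `(0, π)²` and its
derivative annihilates the boost vector field. -/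
theorem exists_hasFDerivAt_sqrt_tan_div_tan {p₁ p₂ : ℝ}
    (h₁ : p₁ ∈ Set.Ioo 0 π) (h₂ : p₂ ∈ Set.Ioo 0 π) :
    ∃ L : ℝ × ℝ →L[ℝ] ℝ,
      HasFDerivAt (fun q : ℝ × ℝ => Real.sqrt (Real.tan (q.1 / 4) / Real.tan (q.2 / 4)))
        L (p₁, p₂) ∧
      Real.sin (p₁ / 2) * L (1, 0) + Real.sin (p₂ / 2) * L (0, 1) = 0 := by
  obtain ⟨hc₁, ht₁⟩ := cos_tan_quarter_pos h₁
  obtain ⟨hc₂, ht₂⟩ := cos_tan_quarter_pos h₂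
  have e₁ := sin_half_mul_deriv_tan_quarter hc₁.ne'
  have e₂ := sin_half_mul_deriv_tan_quarter hc₂.ne'
  have d₁ := (hasDerivAt_tan_quarter hc₁.ne').comp_hasFDerivAt (p₁, p₂)
    (hasFDerivAt_fst (𝕜 := ℝ) (E := ℝ) (F := ℝ))
  have d₂ := ((hasDerivAt_tan_quarter hc₂.ne').fun_inv ht₂.ne').comp_hasFDerivAt (p₁, p₂)
    (hasFDerivAt_snd (𝕜 := ℝ) (E := ℝ) (F := ℝ))
  have d := (d₁.mul d₂).sqrt (mul_pos ht₁ (inv_pos.2 ht₂)).ne'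
  simp_rw [div_eq_mul_inv (Real.tan _)]
  refine ⟨_, d, ?_⟩
  simp only [Function.comp_apply, add_apply, smul_apply, ContinuousLinearMap.coe_fst',
    ContinuousLinearMap.coe_snd', smul_eq_mul]
  generalize 1 / Real.cos (p₁ / 4) ^ 2 * (1 / 4) = a at *
  generalize 1 / Real.cos (p₂ / 4) ^ 2 * (1 / 4) = b at *
  generalize 1 / (2 * √_) = c
  have hb : Real.tan (p₁ / 4) * (Real.tan (p₂ / 4) / 2) / Real.tan (p₂ / 4) ^ 2
      = (Real.tan (p₂ / 4))⁻¹ * (Real.tan (p₁ / 4) / 2) := by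
    field_simp
  linear_combination c * (Real.tan (p₂ / 4))⁻¹ * e₁
    - c * Real.tan (p₁ / 4) / Real.tan (p₂ / 4) ^ 2 * e₂ - c * hb

/-- Every entry of the R-matrix is an affine function of the square root of `T`. -/
theorem RmatrixAdS2_apply_eq_affine (α : ℝ) (i j : Fin 4) :
    ∃ c d : ℝ, ∀ p₁ p₂ : ℝ, RmatrixAdS2 α p₁ p₂ i j =
      c + d * Real.sqrt (Real.tan (p₁ / 4) / Real.tan (p₂ / 4)) := by
  refine ⟨!![1, 0, 0, 0; 0, 1, 0, 0; 0, 0, -1, 0; 0, 0, 0, -1] i j,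
    !![0, 0, 0, α⁻¹ ^ 2; 0, 0, 1, 0; 0, 1, 0, 0; α ^ 2, 0, 0, 0] i j, fun p₁ p₂ => ?_⟩
  fin_cases i <;> fin_cases j <;> simp [RmatrixAdS2]

/-- Every entry `E` of the massless `AdS₂` R-matrix satisfies the boost-annihilation equation
`sin (p₁/2) ∂E/∂p₁ + sin (p₂/2) ∂E/∂p₂ = 0` on `(0,π)²`; equivalently, in the variables
`γᵢ = log (tan (pᵢ/4))` one has `(∂/∂γ₁ + ∂/∂γ₂) R = 0`, so `R` depends only on `γ₁ - γ₂`. -/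
theorem RmatrixAdS2_boost_annihilated (α : ℝ) (hα : α ≠ 0) (i j : Fin 4) (p₁ p₂ : ℝ)
    (h₁ : p₁ ∈ Set.Ioo 0 π) (h₂ : p₂ ∈ Set.Ioo 0 π) :
    Real.sin (p₁ / 2) * fderiv ℝ (fun q : ℝ × ℝ => RmatrixAdS2 α q.1 q.2 i j) (p₁, p₂) (1, 0)
      + Real.sin (p₂ / 2) *
        fderiv ℝ (fun q : ℝ × ℝ => RmatrixAdS2 α q.1 q.2 i j) (p₁, p₂) (0, 1) = 0 := by
  obtain ⟨c, d, hE⟩ := RmatrixAdS2_apply_eq_affine α i j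
  obtain ⟨L, hL, hL0⟩ := exists_hasFDerivAt_sqrt_tan_div_tan h₁ h₂
  simp only [hE]
  rw [((hL.const_mul d).const_add c).fderiv]
  simp only [smul_apply, smul_eq_mul]
  linear_combination d * hL0
end

section
/- For every real θ, the 4×4 matrix R₃(θ) with nonzero entries R₁₁ = 1, R₁₄ = −e^{−θ/2}, R₂₂ = −1, R₂₃ = e^{−θ/2}, R₃₂ = e^{−θ/2}, R₃₃ = 1, R₄₁ = −e^{−θ/2}, R₄₄ = −1 satisfies R₃(θ)·R₃(θ)† = (1 + e^{−θ})·1, where † denotes conjugate transpose and 1 is the 4×4 identity matrix. Hence the normalized S-matrix associated with R₃ is unitary for real rapidity (physical unitarity). -/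
open Matrix

/-- The relativistic massless R-matrix 'Solution 3' of the `AdS₂ × S² × T⁶` superstring
(with `α² = 1`, right-right upper sign). -/
noncomputable def RthreeAdS2 (θ : ℝ) : Matrix (Fin 4) (Fin 4) ℂ :=
  !![1, 0, 0, -Complex.exp (-θ / 2);
     0, -1, Complex.exp (-θ / 2), 0;
     0, Complex.exp (-θ / 2), 1, 0;
     -Complex.exp (-θ / 2), 0, 0, -1]

/-- The off-diagonal entry of `RthreeAdS2` is, up to sign, the complex cast of a real number. -/
theorem exp_neg_ofReal_div_two (θ : ℝ) :
    Complex.exp (-θ / 2) = (Real.exp (-θ / 2) : ℂ) := by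
  push_cast
  rfl

/-- Physical unitarity of 'Solution 3': for every real `θ`,
`R₃(θ) · R₃(θ)ᴴ = (1 + e^{-θ}) · 1`, so the normalized S-matrix is unitary. -/
theorem RthreeAdS2_physical_unitarity (θ : ℝ) :
    RthreeAdS2 θ * (RthreeAdS2 θ)ᴴ = ((1 + Real.exp (-θ) : ℝ) : ℂ) • 1 := by
  have hsq : (Real.exp (-θ / 2) : ℂ) * Real.exp (-θ / 2) = Real.exp (-θ) := by
    rw [← Complex.ofReal_mul, ← Real.exp_add, add_halves]
  rw [RthreeAdS2, exp_neg_ofReal_div_two]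
  generalize Real.exp (-θ / 2) = x at hsq ⊢
  ext i j
  fin_cases i <;> fin_cases j <;>
    simp [Matrix.mul_apply, Fin.sum_univ_four, -Complex.ofReal_exp, hsq, add_comm]
end

section
/- Let Ω₃, Ω₅ : ℂ → ℂ with Ω₃ nowhere vanishing. Assume: (i) Ω₅(−z)·Ω₃(z) = 1/(1 + e^{−z}) for all z ∈ ℂ with 1 + e^{−z} ≠ 0 (mixed braiding unitarity), and (ii) Ω₃(z)·Ω₃(z + iπ) = e^{z/2}/(2 cosh(z/2)) for all z with cosh(z/2) ≠ 0 (crossing). Then for every θ ∈ ℂ with sinh(θ/2) ≠ 0 and cosh(θ/2) ≠ 0, one has Ω₅(θ)·Ω₅(θ + iπ) = e^{−θ/2}/(2 cosh(θ/2)). -/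
open Complex

theorem one_add_exp_eq_exp_half_mul_cosh_half (z : ℂ) :
    1 + Complex.exp z = Complex.exp (z / 2) * (2 * Complex.cosh (z / 2)) := by
  rw [Complex.two_cosh, mul_add, ← Complex.exp_add, ← Complex.exp_add, add_halves,
    add_neg_cancel, Complex.exp_zero, add_comm]

theorem one_sub_exp_eq_exp_half_mul_sinh_half (z : ℂ) :
    1 - Complex.exp z = -(Complex.exp (z / 2) * (2 * Complex.sinh (z / 2))) := by
  rw [Complex.two_sinh, mul_sub, ← Complex.exp_add, ← Complex.exp_add, add_halves,
    add_neg_cancel, Complex.exp_zero, neg_sub]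

theorem exp_neg_half_div_cosh_half (z : ℂ) :
    Complex.exp (-z / 2) / (2 * Complex.cosh (z / 2)) = 1 / (1 + Complex.exp z) := by
  rw [one_add_exp_eq_exp_half_mul_cosh_half, neg_div, Complex.exp_neg, one_div, mul_inv,
    div_eq_mul_inv]

/-- Mixed braiding unitarity `Ω₅(-z) Ω₃(z) = 1/(1 + e^{-z})` together with the crossing
relation `Ω₃(z) Ω₃(z + iπ) = e^{z/2} / (2 cosh (z/2))` imply the crossing relation for `Ω₅`:
`Ω₅(θ) Ω₅(θ + iπ) = e^{-θ/2} / (2 cosh (θ/2))`. -/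
theorem crossing_for_Omega5 (Ω₃ Ω₅ : ℂ → ℂ) (hne : ∀ z : ℂ, Ω₃ z ≠ 0)
    (hmixed : ∀ z : ℂ, 1 + Complex.exp (-z) ≠ 0 →
      Ω₅ (-z) * Ω₃ z = 1 / (1 + Complex.exp (-z)))
    (hcross : ∀ z : ℂ, Complex.cosh (z / 2) ≠ 0 →
      Ω₃ z * Ω₃ (z + Real.pi * Complex.I) = Complex.exp (z / 2) / (2 * Complex.cosh (z / 2))) :
    ∀ θ : ℂ, Complex.sinh (θ / 2) ≠ 0 → Complex.cosh (θ / 2) ≠ 0 →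
      Ω₅ θ * Ω₅ (θ + Real.pi * Complex.I) =
        Complex.exp (-θ / 2) / (2 * Complex.cosh (θ / 2)) := by
  intro θ hs hc
  have h_add : 1 + Complex.exp θ ≠ 0 := by
    rw [one_add_exp_eq_exp_half_mul_cosh_half]
    exact mul_ne_zero (Complex.exp_ne_zero _) (mul_ne_zero two_ne_zero hc)
  have h_sub : 1 - Complex.exp θ ≠ 0 := by
    rw [one_sub_exp_eq_exp_half_mul_sinh_half]
    exact neg_ne_zero.mpr (mul_ne_zero (Complex.exp_ne_zero _) (mul_ne_zero two_ne_zero hs))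
  set w : ℂ := θ + Real.pi * Complex.I with hw
  have h_exp : 1 + Complex.exp w = 1 - Complex.exp θ := by
    rw [hw, Complex.exp_add, Complex.exp_pi_mul_I]
    ring
  have hm₁ : Ω₅ θ * Ω₃ (-θ) = 1 / (1 + Complex.exp θ) := by
    simpa only [neg_neg] using hmixed (-θ) (by rwa [neg_neg])
  have hm₂ : Ω₅ w * Ω₃ (-w) = 1 / (1 - Complex.exp θ) := by
    simpa only [neg_neg, h_exp] using hmixed (-w) (by rwa [neg_neg, h_exp])
  have h_cosh : Complex.cosh (-w / 2) ≠ 0 := by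
    intro h
    rw [neg_div, Complex.cosh_neg] at h
    apply h_sub
    rw [← h_exp, one_add_exp_eq_exp_half_mul_cosh_half, h, mul_zero, mul_zero]
  have hcr : Ω₃ (-w) * Ω₃ (-θ) = 1 / (1 - Complex.exp θ) := by
    have h := hcross (-w) h_cosh
    rwa [show -w + Real.pi * Complex.I = -θ by rw [hw]; ring, neg_div 2 w, Complex.cosh_neg,
      ← neg_div, exp_neg_half_div_cosh_half, h_exp] at h
  have h_eq : Ω₅ w = Ω₃ (-θ) :=
    mul_right_cancel₀ (hne (-w)) (by rw [hm₂, mul_comm, hcr])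
  rw [h_eq, hm₁, exp_neg_half_div_cosh_half]
end

section
/- The infinite product ∏_{j=1}^{∞} e^{−1/(2j)} · j · Γ(j − 1/2)/Γ(j + 1/2) (real Gamma function) converges, and its value is √π · e^{−γ_EM/2}, where γ_EM is the Euler–Mascheroni constant. Equivalently, ∏_{j=1}^{∞} (1 − 1/(2j))·e^{1/(2j)} = e^{γ_EM/2}/√π. Consequently, the dressing factor Ω(θ) = (e^{γ_EM/2 − iπ/8 + θ/4}/√(2π)) ∏_{j=1}^∞ e^{−1/(2j)} j Γ(j−1/2+θ/(2πi))Γ(j−θ/(2πi)) / [Γ(j+1/2−θ/(2πi))Γ(j+θ/(2πi))] satisfies Ω(0) = e^{−iπ/8}/√2. -/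
open Real

/-- The minimal dressing factor of the relativistic massless 'Solution 3' R-matrix of the
`AdS₂ × S² × T⁶` superstring, as an infinite product of Gamma functions (here `x = θ/(2πi)`). -/
noncomputable def OmegaAdS2 (θ : ℝ) : ℂ :=
  (Complex.exp ((Real.eulerMascheroniConstant : ℂ) / 2 - Real.pi * Complex.I / 8 + (θ : ℂ) / 4)
      / (Real.sqrt (2 * Real.pi) : ℂ)) *
  ∏' j : ℕ,
    (Complex.exp (-(1 / (2 * ((j : ℂ) + 1)))) * ((j : ℂ) + 1) *
      (Complex.Gamma ((j : ℂ) + 1 - 1 / 2 + (θ : ℂ) / (2 * Real.pi * Complex.I)) *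
          Complex.Gamma ((j : ℂ) + 1 - (θ : ℂ) / (2 * Real.pi * Complex.I)) /
        (Complex.Gamma ((j : ℂ) + 1 + 1 / 2 - (θ : ℂ) / (2 * Real.pi * Complex.I)) *
          Complex.Gamma ((j : ℂ) + 1 + (θ : ℂ) / (2 * Real.pi * Complex.I)))))

open Filter Topology

/-- The elementary form `e^{-1/(2j)} j / (j - 1/2)` of the factors, with `j` shifted by one. -/
noncomputable def halfWeierstrassFactor (j : ℕ) : ℝ :=
  Real.exp (-(1 / (2 * ((j : ℝ) + 1)))) * ((j : ℝ) + 1) / ((j : ℝ) + 1 / 2)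

lemma halfWeierstrassFactor_pos (j : ℕ) : 0 < halfWeierstrassFactor j := by
  unfold halfWeierstrassFactor
  positivity

lemma halfWeierstrassFactor_inv (j : ℕ) :
    (halfWeierstrassFactor j)⁻¹ =
      (1 - 1 / (2 * ((j : ℝ) + 1))) * Real.exp (1 / (2 * ((j : ℝ) + 1))) := by
  have h1 : (j : ℝ) + 1 ≠ 0 := by positivity
  have h2 : (j : ℝ) + 1 / 2 ≠ 0 := by positivity
  rw [halfWeierstrassFactor, Real.exp_neg, inv_div]
  field_simp
  ring

lemma one_le_halfWeierstrassFactor (j : ℕ) : 1 ≤ halfWeierstrassFactor j := by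
  rw [← inv_le_one₀ (halfWeierstrassFactor_pos j), halfWeierstrassFactor_inv]
  calc (1 - 1 / (2 * ((j : ℝ) + 1))) * Real.exp (1 / (2 * ((j : ℝ) + 1)))
      ≤ Real.exp (-(1 / (2 * ((j : ℝ) + 1)))) * Real.exp (1 / (2 * ((j : ℝ) + 1))) := by
        gcongr
        exact Real.one_sub_le_exp_neg _
    _ = 1 := by rw [← Real.exp_add, neg_add_cancel, Real.exp_zero]

lemma prod_halfWeierstrassFactor {n : ℕ} (hn : n ≠ 0) :
    ∏ j ∈ Finset.range n, halfWeierstrassFactor j =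
      Real.exp (-Real.eulerMascheroniSeq' n / 2) * Real.GammaSeq (1 / 2) n *
        (1 + 1 / 2 / (n : ℝ)) := by
  have hn' : (0 : ℝ) < n := by positivity
  have hprod : ∏ j ∈ Finset.range n, ((j : ℝ) + 1 / 2) ≠ 0 :=
    Finset.prod_ne_zero_iff.2 fun j _ => by positivity
  have hfact : ∏ j ∈ Finset.range n, ((j : ℝ) + 1) = n.factorial := by
    rw [← Finset.prod_range_add_one_eq_factorial]
    push_cast
    rfl
  have hsum : ∑ j ∈ Finset.range n, -(1 / (2 * ((j : ℝ) + 1))) = -(harmonic n : ℝ) / 2 := by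
    rw [harmonic]
    push_cast
    rw [neg_div, Finset.sum_div, ← Finset.sum_neg_distrib]
    refine Finset.sum_congr rfl fun j _ => ?_
    field_simp
  have hexp : Real.exp (-((harmonic n : ℝ) - Real.log n) / 2) =
      Real.exp (-(harmonic n : ℝ) / 2) * (n : ℝ) ^ (1 / 2 : ℝ) := by
    rw [Real.rpow_def_of_pos hn', ← Real.exp_add]
    ring_nf
  have hsq : (n : ℝ) ^ (1 / 2 : ℝ) * (n : ℝ) ^ (1 / 2 : ℝ) = n := by
    rw [← Real.rpow_add hn']
    norm_num
  simp only [halfWeierstrassFactor]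
  rw [Finset.prod_div_distrib, Finset.prod_mul_distrib, ← Real.exp_sum, hsum, hfact,
    Real.eulerMascheroniSeq', if_neg hn, hexp, Real.GammaSeq, Finset.prod_range_succ]
  simp only [add_comm (1 / 2 : ℝ)]
  have h3 : (n : ℝ) + 1 / 2 ≠ 0 := by positivity
  calc _ = Real.exp (-(harmonic n : ℝ) / 2) * n.factorial /
        (∏ j ∈ Finset.range n, ((j : ℝ) + 1 / 2)) *
        (((n : ℝ) ^ (1 / 2 : ℝ) * (n : ℝ) ^ (1 / 2 : ℝ)) / n) := by
        rw [hsq, div_self hn'.ne', mul_one]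
    _ = _ := by
        generalize (n : ℝ) ^ (1 / 2 : ℝ) = r
        field_simp

lemma tendsto_prod_halfWeierstrassFactor :
    Tendsto (fun n : ℕ => ∏ j ∈ Finset.range n, halfWeierstrassFactor j) atTop
      (𝓝 (Real.sqrt Real.pi * Real.exp (-Real.eulerMascheroniConstant / 2))) := by
  have h1 : Tendsto (fun n : ℕ => Real.exp (-Real.eulerMascheroniSeq' n / 2)) atTop
      (𝓝 (Real.exp (-Real.eulerMascheroniConstant / 2))) :=
    (Real.continuous_exp.tendsto _).comp (Real.tendsto_eulerMascheroniSeq'.neg.div_const 2)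
  have h2 := Real.GammaSeq_tendsto_Gamma (1 / 2)
  have h3 : Tendsto (fun n : ℕ => 1 + 1 / 2 / (n : ℝ)) atTop (𝓝 (1 + 0)) :=
    (tendsto_const_div_atTop_nhds_zero_nat (1 / 2)).const_add 1
  rw [Real.Gamma_one_half_eq] at h2
  have h := (h1.mul h2).mul h3
  rw [add_zero, mul_one, mul_comm] at h
  refine h.congr' ?_
  filter_upwards [eventually_ne_atTop 0] with n hn using (prod_halfWeierstrassFactor hn).symm

lemma hasSum_log_halfWeierstrassFactor :
    HasSum (fun j => Real.log (halfWeierstrassFactor j))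
      (Real.log (Real.sqrt Real.pi * Real.exp (-Real.eulerMascheroniConstant / 2))) := by
  rw [hasSum_iff_tendsto_nat_of_nonneg fun j => Real.log_nonneg (one_le_halfWeierstrassFactor j)]
  refine (tendsto_prod_halfWeierstrassFactor.log (by positivity)).congr fun n => ?_
  exact Real.log_prod fun j _ => (halfWeierstrassFactor_pos j).ne'

lemma hasProd_halfWeierstrassFactor :
    HasProd halfWeierstrassFactor
      (Real.sqrt Real.pi * Real.exp (-Real.eulerMascheroniConstant / 2)) := by
  have h := hasSum_log_halfWeierstrassFactor.rexp
  rw [Real.exp_log (by positivity)] at h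
  convert h using 1
  funext j
  simp [Real.exp_log (halfWeierstrassFactor_pos j)]

lemma hasProd_halfWeierstrassFactor_inv :
    HasProd (fun j => (halfWeierstrassFactor j)⁻¹)
      (Real.exp (Real.eulerMascheroniConstant / 2) / Real.sqrt Real.pi) := by
  have h := hasSum_log_halfWeierstrassFactor.neg.rexp
  have hv : Real.exp (-Real.log (Real.sqrt Real.pi *
      Real.exp (-Real.eulerMascheroniConstant / 2))) =
      Real.exp (Real.eulerMascheroniConstant / 2) / Real.sqrt Real.pi := by
    rw [Real.exp_neg, Real.exp_log (by positivity), mul_inv, ← Real.exp_neg, div_eq_inv_mul]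
    ring_nf
  rw [hv] at h
  convert h using 1
  funext j
  simp [Real.exp_neg, Real.exp_log (halfWeierstrassFactor_pos j)]

lemma halfWeierstrassFactor_eq_Gamma (j : ℕ) :
    Real.exp (-(1 / (2 * ((j : ℝ) + 1)))) * ((j : ℝ) + 1) *
        (Real.Gamma ((j : ℝ) + 1 - 1 / 2) / Real.Gamma ((j : ℝ) + 1 + 1 / 2)) =
      halfWeierstrassFactor j := by
  have h1 : (j : ℝ) + 1 / 2 ≠ 0 := by positivity
  have h2 : Real.Gamma ((j : ℝ) + 1 / 2) ≠ 0 := (Real.Gamma_pos_of_pos (by positivity)).ne'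
  rw [halfWeierstrassFactor, show (j : ℝ) + 1 - 1 / 2 = j + 1 / 2 by ring,
    show (j : ℝ) + 1 + 1 / 2 = (j + 1 / 2) + 1 by ring, Real.Gamma_add_one h1]
  field_simp

lemma halfWeierstrassFactor_eq_Complex_Gamma (j : ℕ) :
    Complex.exp (-(1 / (2 * ((j : ℂ) + 1)))) * ((j : ℂ) + 1) *
      (Complex.Gamma ((j : ℂ) + 1 - 1 / 2) * Complex.Gamma ((j : ℂ) + 1) /
        (Complex.Gamma ((j : ℂ) + 1 + 1 / 2) * Complex.Gamma ((j : ℂ) + 1))) =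
      (halfWeierstrassFactor j : ℂ) := by
  have h : Complex.Gamma ((j : ℂ) + 1) ≠ 0 := by
    rw [Complex.Gamma_nat_eq_factorial]
    exact_mod_cast j.factorial_ne_zero
  rw [mul_div_mul_right _ _ h, ← halfWeierstrassFactor_eq_Gamma]
  push_cast [← Complex.Gamma_ofReal]
  rfl

/-- The infinite product `∏_{j≥1} e^{-1/(2j)} j Γ(j - 1/2)/Γ(j + 1/2)` converges to
`√π e^{-γ_EM/2}`; equivalently `∏_{j≥1} (1 - 1/(2j)) e^{1/(2j)} = e^{γ_EM/2}/√π`.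
Consequently the dressing factor `Ω` satisfies `Ω(0) = e^{-iπ/8}/√2`. -/
theorem OmegaAdS2_at_zero :
    (Multipliable fun j : ℕ =>
      Real.exp (-(1 / (2 * ((j : ℝ) + 1)))) * ((j : ℝ) + 1) *
        (Real.Gamma ((j : ℝ) + 1 - 1 / 2) / Real.Gamma ((j : ℝ) + 1 + 1 / 2))) ∧
    (∏' j : ℕ,
      Real.exp (-(1 / (2 * ((j : ℝ) + 1)))) * ((j : ℝ) + 1) *
        (Real.Gamma ((j : ℝ) + 1 - 1 / 2) / Real.Gamma ((j : ℝ) + 1 + 1 / 2))) =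
      Real.sqrt Real.pi * Real.exp (-Real.eulerMascheroniConstant / 2) ∧
    (Multipliable fun j : ℕ =>
      (1 - 1 / (2 * ((j : ℝ) + 1))) * Real.exp (1 / (2 * ((j : ℝ) + 1)))) ∧
    (∏' j : ℕ, (1 - 1 / (2 * ((j : ℝ) + 1))) * Real.exp (1 / (2 * ((j : ℝ) + 1)))) =
      Real.exp (Real.eulerMascheroniConstant / 2) / Real.sqrt Real.pi ∧
    OmegaAdS2 0 = Complex.exp (-(Real.pi : ℂ) * Complex.I / 8) / (Real.sqrt 2 : ℂ) := by
  simp only [halfWeierstrassFactor_eq_Gamma, ← halfWeierstrassFactor_inv]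
  refine ⟨hasProd_halfWeierstrassFactor.multipliable, hasProd_halfWeierstrassFactor.tprod_eq,
    hasProd_halfWeierstrassFactor_inv.multipliable, hasProd_halfWeierstrassFactor_inv.tprod_eq, ?_⟩
  have htprod : ∏' j : ℕ, (halfWeierstrassFactor j : ℂ) =
      ((Real.sqrt Real.pi * Real.exp (-Real.eulerMascheroniConstant / 2) : ℝ) : ℂ) :=
    (hasProd_halfWeierstrassFactor.map Complex.ofRealHom Complex.continuous_ofReal).tprod_eq
  have hsqrt : (Real.sqrt Real.pi : ℂ) ≠ 0 := by
    exact_mod_cast (Real.sqrt_pos.2 Real.pi_pos).ne'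
  have hexp : Complex.exp ((Real.eulerMascheroniConstant : ℂ) / 2 - Real.pi * Complex.I / 8) *
      Complex.exp (-(Real.eulerMascheroniConstant : ℂ) / 2) =
      Complex.exp (-(Real.pi : ℂ) * Complex.I / 8) := by
    rw [← Complex.exp_add]
    ring_nf
  simp only [OmegaAdS2, Complex.ofReal_zero, zero_div, add_zero, sub_zero,
    halfWeierstrassFactor_eq_Complex_Gamma]
  rw [htprod, Real.sqrt_mul zero_le_two, ← hexp]
  push_cast
  field_simp
end

section
/- For every real θ, define Ω(θ) = (e^{γ_EM/2 − iπ/8 + θ/4}/√(2π)) ∏_{j=1}^∞ e^{−1/(2j)} · j · Γ(j − 1/2 + x)Γ(j − x) / [Γ(j + 1/2 − x)Γ(j + x)], where x = θ/(2πi) and Γ is the complex Gamma function. Then the product converges for all real θ and Ω(θ)·Ω(−θ) = e^{−iπ/4}/(2 cosh(θ/2)). -/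
open Real

open Filter Topology in
open scoped Nat in
theorem tendsto_Gamma_add_nat_div {s : ℂ} (hs : 0 < s.re) :
    Tendsto (fun n : ℕ => Complex.Gamma (s + n + 1) / ((n : ℂ) ^ s * (n ! : ℂ))) atTop (𝓝 1) := by
  have hprod : ∀ n : ℕ,
      Complex.Gamma (s + n + 1) = Complex.Gamma s * ∏ j ∈ Finset.range (n + 1), (s + j) := by
    have hne : ∀ n : ℕ, s + n ≠ 0 := fun n h => by
      have := congrArg Complex.re h
      simp at this
      have : (0 : ℝ) ≤ n := n.cast_nonneg
      linarith
    intro n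
    induction n with
    | zero => simpa [mul_comm] using Complex.Gamma_add_one s (by simpa using hne 0)
    | succ n ih =>
      rw [Complex.Gamma_add_one _ (hne _), Finset.prod_range_succ, ← mul_assoc, ← ih]
      push_cast
      rw [← add_assoc, mul_comm]
  have hΓ := Complex.Gamma_ne_zero_of_re_pos hs
  have h := (Complex.GammaSeq_tendsto_Gamma s).inv₀ hΓ |>.const_mul (Complex.Gamma s)
  rw [mul_inv_cancel₀ hΓ] at h
  refine h.congr fun n => ?_
  rw [hprod, Complex.GammaSeq, inv_div, mul_div_assoc]

/-- The `(j + 1)`-st factor of the infinite product defining `OmegaAdS2`. -/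
noncomputable def dressingFactor (x : ℂ) (j : ℕ) : ℂ :=
  Complex.exp (-(1 / (2 * ((j : ℂ) + 1)))) * ((j : ℂ) + 1) *
    (Complex.Gamma ((j : ℂ) + 1 - 1 / 2 + x) * Complex.Gamma ((j : ℂ) + 1 - x) /
      (Complex.Gamma ((j : ℂ) + 1 + 1 / 2 - x) * Complex.Gamma ((j : ℂ) + 1 + x)))

open Filter Topology in
open scoped Nat in
theorem tendsto_dressingFactor {x : ℂ} (hx : x.re = 0) :
    Tendsto (dressingFactor x) atTop (𝓝 1) := by
  rw [← tendsto_add_atTop_iff_nat 1]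
  have h1 := tendsto_Gamma_add_nat_div (s := 1 / 2 + x) (by norm_num [hx])
  have h2 := tendsto_Gamma_add_nat_div (s := 1 - x) (by norm_num [hx])
  have h3 := tendsto_Gamma_add_nat_div (s := 3 / 2 - x) (by norm_num [hx])
  have h4 := tendsto_Gamma_add_nat_div (s := 1 + x) (by norm_num [hx])
  have hinv : Tendsto (fun n : ℕ => ((n : ℂ))⁻¹) atTop (𝓝 0) :=
    tendsto_inv_atTop_nhds_zero_nat
  have hinv2 : Tendsto (fun n : ℕ => (((n + 2 : ℕ) : ℂ))⁻¹) atTop (𝓝 0) :=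
    hinv.comp (tendsto_add_atTop_nat 2)
  have he : Tendsto (fun n : ℕ => Complex.exp (-(1 / 2) * (((n + 2 : ℕ) : ℂ))⁻¹)) atTop (𝓝 1) := by
    have := (Complex.continuous_exp.tendsto _).comp (hinv2.const_mul (-(1 / 2)))
    simpa [Function.comp_def] using this
  have hq : Tendsto (fun n : ℕ => 1 + 2 * ((n : ℂ))⁻¹) atTop (𝓝 1) := by
    simpa using (hinv.const_mul 2).const_add 1
  have h := (he.mul hq).mul ((h1.mul h2).div (h3.mul h4) (by norm_num))
  simp only [mul_one, div_one] at h
  refine h.congr' ?_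
  filter_upwards [eventually_ne_atTop 0] with n hn
  have hn' : (n : ℂ) ≠ 0 := Nat.cast_ne_zero.mpr hn
  have hf : (n ! : ℂ) ≠ 0 := Nat.cast_ne_zero.mpr n.factorial_ne_zero
  have hpow : (n : ℂ) ^ (3 / 2 - x) * (n : ℂ) ^ (1 + x) =
      n * ((n : ℂ) ^ (1 / 2 + x) * (n : ℂ) ^ (1 - x)) := by
    rw [← Complex.cpow_add _ _ hn', ← Complex.cpow_add _ _ hn']
    conv_rhs => enter [1]; rw [← Complex.cpow_one (n : ℂ)]
    rw [← Complex.cpow_add _ _ hn']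
    ring_nf
  have hp1 : (n : ℂ) ^ (1 / 2 + x) ≠ 0 := by simp [Complex.cpow_eq_zero_iff, hn]
  have hp2 : (n : ℂ) ^ (1 - x) ≠ 0 := by simp [Complex.cpow_eq_zero_iff, hn]
  have hn2 : (n : ℂ) + 1 + 1 ≠ 0 := by exact_mod_cast (by omega : n + 1 + 1 ≠ 0)
  have e0 : -(1 / 2) * (((n + 2 : ℕ) : ℂ))⁻¹ = -(1 / (2 * ((n : ℂ) + 1 + 1))) := by
    push_cast
    rw [show (n : ℂ) + 2 = n + 1 + 1 by ring]
    field_simp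
  have e1 : 1 / 2 + x + (n : ℂ) + 1 = (n : ℂ) + 1 + 1 - 1 / 2 + x := by ring
  have e2 : 1 - x + (n : ℂ) + 1 = (n : ℂ) + 1 + 1 - x := by ring
  have e3 : 3 / 2 - x + (n : ℂ) + 1 = (n : ℂ) + 1 + 1 + 1 / 2 - x := by ring
  have e4 : 1 + x + (n : ℂ) + 1 = (n : ℂ) + 1 + 1 + x := by ring
  simp only [Pi.div_apply]
  rw [e0, e1, e2, e3, e4, div_mul_div_comm, div_mul_div_comm, div_div_div_eq]
  have hfrac : ∀ a b : ℂ,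
      a * ((n : ℂ) ^ (3 / 2 - x) * (n ! : ℂ) * ((n : ℂ) ^ (1 + x) * (n ! : ℂ))) /
      ((n : ℂ) ^ (1 / 2 + x) * (n ! : ℂ) * ((n : ℂ) ^ (1 - x) * (n ! : ℂ)) * b) = n * (a / b) := by
    intro a b
    rw [show (n : ℂ) ^ (3 / 2 - x) * (n ! : ℂ) * ((n : ℂ) ^ (1 + x) * (n ! : ℂ)) =
      n * ((n : ℂ) ^ (1 / 2 + x) * (n ! : ℂ) * ((n : ℂ) ^ (1 - x) * (n ! : ℂ))) by
        linear_combination (n ! : ℂ) ^ 2 * hpow]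
    rw [show a * (n * ((n : ℂ) ^ (1 / 2 + x) * (n ! : ℂ) * ((n : ℂ) ^ (1 - x) * (n ! : ℂ)))) =
      ((n : ℂ) ^ (1 / 2 + x) * (n ! : ℂ) * ((n : ℂ) ^ (1 - x) * (n ! : ℂ))) * (n * a) by ring,
      mul_div_mul_left _ _ (by positivity), mul_div_assoc]
  rw [hfrac, dressingFactor]
  push_cast
  field_simp
  ring

theorem dressingFactor_succ {x : ℂ} (hx : x.re = 0) (j : ℕ) :
    dressingFactor x (j + 1) = dressingFactor x j *
      (Complex.exp (1 / (2 * (j + 1) * (j + 2))) * ((j + 2) / (j + 1) *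
        ((j + 1 / 2 + x) * (j + 1 - x) / ((j + 3 / 2 - x) * (j + 1 + x))))) := by
  have hre : ∀ (c : ℝ) (y : ℂ), 0 < c → y.re = 0 → (j : ℂ) + c + y ≠ 0 := fun c y hc hy h => by
    have := congrArg Complex.re h
    simp [hy] at this
    have : (0 : ℝ) ≤ j := j.cast_nonneg
    linarith
  have hxn : (-x).re = 0 := by simp [hx]
  have k1 : (j : ℂ) + 1 - 1 / 2 + x ≠ 0 := by
    convert hre (1 / 2) x (by norm_num) hx using 1; push_cast; ring
  have k2 : (j : ℂ) + 1 - x ≠ 0 := by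
    convert hre 1 (-x) (by norm_num) hxn using 1; push_cast; ring
  have k3 : (j : ℂ) + 1 + 1 / 2 - x ≠ 0 := by
    convert hre (3 / 2) (-x) (by norm_num) hxn using 1; push_cast; ring
  have k4 : (j : ℂ) + 1 + x ≠ 0 := by
    convert hre 1 x (by norm_num) hx using 1; push_cast; ring
  have k5 : (j : ℂ) + 1 ≠ 0 := by exact_mod_cast (by omega : j + 1 ≠ 0)
  have k6 : (j : ℂ) + 2 ≠ 0 := by exact_mod_cast (by omega : j + 2 ≠ 0)
  have e0 : Complex.exp (-(1 / (2 * ((j : ℂ) + 1 + 1)))) =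
      Complex.exp (-(1 / (2 * ((j : ℂ) + 1)))) *
        Complex.exp (1 / (2 * (j + 1) * (j + 2))) := by
    rw [← Complex.exp_add]
    congr 1
    rw [show (j : ℂ) + 1 + 1 = j + 2 by ring]
    field_simp
    ring
  have e1 : (j : ℂ) + 1 + 1 - 1 / 2 + x = ((j : ℂ) + 1 - 1 / 2 + x) + 1 := by ring
  have e2 : (j : ℂ) + 1 + 1 - x = ((j : ℂ) + 1 - x) + 1 := by ring
  have e3 : (j : ℂ) + 1 + 1 + 1 / 2 - x = ((j : ℂ) + 1 + 1 / 2 - x) + 1 := by ring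
  have e4 : (j : ℂ) + 1 + 1 + x = ((j : ℂ) + 1 + x) + 1 := by ring
  have e5 : (j : ℂ) + 1 / 2 + x = (j : ℂ) + 1 - 1 / 2 + x := by ring
  have e6 : (j : ℂ) + 3 / 2 - x = (j : ℂ) + 1 + 1 / 2 - x := by ring
  rw [dressingFactor, dressingFactor]
  push_cast
  rw [e0, e1, e2, e3, e4, e5, e6, Complex.Gamma_add_one _ k1, Complex.Gamma_add_one _ k2,
    Complex.Gamma_add_one _ k3, Complex.Gamma_add_one _ k4, mul_mul_mul_comm,
    mul_mul_mul_comm ((j : ℂ) + 1 + 1 / 2 - x), mul_div_mul_comm]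
  field_simp
  ring

theorem norm_dressingFactor_ratio_sub_one_le {x : ℂ} (hx : x.re = 0) (j : ℕ) :
    ‖Complex.exp (1 / (2 * (j + 1) * (j + 2))) * ((j + 2) / (j + 1) *
        ((j + 1 / 2 + x) * (j + 1 - x) / ((j + 3 / 2 - x) * (j + 1 + x)))) - 1‖ ≤
      (4 * ‖x / 2 - x ^ 2‖ + 4) / ((j : ℝ) + 1) ^ 3 := by
  have hj : (0 : ℝ) ≤ j := j.cast_nonneg
  set t : ℝ := (j : ℝ) + 1 with ht
  have ht1 : 1 ≤ t := by linarith
  have ht0 : 0 < t := by linarith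
  set p : ℂ := x / 2 - x ^ 2 with hp
  have ejt : (j : ℂ) = t - 1 := by rw [ht]; push_cast; ring
  have hnorm : ∀ (c : ℝ) (y : ℂ), 0 ≤ c → y.re = 0 → t ≤ ‖(t : ℂ) + c + y‖ := fun c y hc hy => by
    refine le_trans ?_ (Complex.re_le_norm _)
    simp [hy, hc]
  set D : ℂ := t * (((t : ℂ) + 1 / 2 - x) * (t + x)) with hD
  have hDn : t ^ 3 ≤ ‖D‖ := by
    have a1 := hnorm (1 / 2) (-x) (by norm_num) (by simp [hx])
    have a2 := hnorm 0 x le_rfl hx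
    rw [show (t : ℂ) + (1 / 2 : ℝ) + -x = t + 1 / 2 - x by push_cast; ring] at a1
    rw [show (t : ℂ) + (0 : ℝ) + x = t + x by push_cast; ring] at a2
    rw [hD, norm_mul, norm_mul, Complex.norm_real, Real.norm_of_nonneg ht0.le, pow_succ' t 2, sq]
    gcongr
  have hD0 : D ≠ 0 := by
    rw [← norm_pos_iff]
    exact lt_of_lt_of_le (by positivity) hDn
  have htc : (t : ℂ) ≠ 0 := by exact_mod_cast ht0.ne'
  have htc1 : (t : ℂ) + 1 ≠ 0 := by exact_mod_cast (by linarith : t + 1 ≠ 0)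
  set u : ℂ := 1 / (2 * t * (t + 1)) with hu
  set q : ℂ := p - t / 2 with hq
  have hun : ‖u‖ ≤ 1 / (2 * t ^ 2) := by
    have : u = ((1 / (2 * t * (t + 1)) : ℝ) : ℂ) := by rw [hu]; push_cast; rfl
    rw [this, Complex.norm_real, Real.norm_of_nonneg (by positivity)]
    apply one_div_le_one_div_of_le (by positivity)
    nlinarith
  have hqn : ‖q‖ ≤ ‖p‖ + t / 2 := by
    refine (norm_sub_le _ _).trans_eq ?_
    rw [norm_div, Complex.norm_real, Real.norm_of_nonneg ht0.le]
    norm_num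
  have hratio : ((j : ℂ) + 2) / (j + 1) *
      ((j + 1 / 2 + x) * (j + 1 - x) / ((j + 3 / 2 - x) * (j + 1 + x))) = 1 + q / D := by
    have hd : ((t : ℂ) + 1 / 2 - x) * (t + x) ≠ 0 := right_ne_zero_of_mul hD0
    rw [ejt, show (t : ℂ) - 1 + 2 = t + 1 by ring, show (t : ℂ) - 1 + 1 = t by ring,
      show (t : ℂ) - 1 + 1 / 2 + x = t - 1 / 2 + x by ring,
      show (t : ℂ) - 1 + 3 / 2 - x = t + 1 / 2 - x by ring, div_mul_div_comm, ← hD, eq_comm,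
      one_add_div hD0]
    congr 1
    rw [hD, hq, hp]
    ring
  have hexp : Complex.exp (1 / (2 * ((j : ℂ) + 1) * (j + 2))) = Complex.exp u := by
    rw [hu, ejt]
    ring_nf
  have hsplit : Complex.exp u * (1 + q / D) - 1 =
      (Complex.exp u - 1 - u) * (1 + q / D) + (q / (2 * (t + 1)) + p + u * q) / D := by
    have : u * D = (t ^ 2 + t / 2 + p) / (2 * (t + 1)) := by
      rw [hu, hD, hp]
      field_simp
      ring
    have h2 : u * D + q = q / (2 * (t + 1)) + p := by
      rw [this, hq]
      field_simp
      ring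
    rw [← h2]
    field_simp
    ring
  rw [hratio, hexp, hsplit]
  have hb1 : ‖Complex.exp u - 1 - u‖ ≤ 1 / t ^ 3 / 2 := by
    have ht3 : t ^ 3 ≤ t ^ 4 := pow_le_pow_right₀ ht1 (by norm_num)
    have hu1 : ‖u‖ ≤ 1 := hun.trans (by rw [div_le_one (by positivity)]; nlinarith)
    calc _ ≤ ‖u‖ ^ 2 := Complex.norm_exp_sub_one_sub_id_le hu1
      _ ≤ (1 / (2 * t ^ 2)) ^ 2 := by gcongr
      _ = 1 / (4 * t ^ 4) := by field_simp; norm_num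
      _ ≤ 1 / (2 * t ^ 3) := one_div_le_one_div_of_le (by positivity) (by linarith [pow_pos ht0 4])
      _ = _ := by field_simp
  have hb2 : ‖1 + q / D‖ ≤ ‖p‖ + 2 := by
    have : ‖q / D‖ ≤ ‖p‖ + 1 := by
      rw [norm_div, div_le_iff₀ (by positivity)]
      have h3 : t ≤ t ^ 3 := le_self_pow₀ ht1 (by norm_num)
      have h4 : ‖p‖ * 1 ≤ ‖p‖ * ‖D‖ := by gcongr; linarith
      linarith
    calc _ ≤ ‖(1 : ℂ)‖ + ‖q / D‖ := norm_add_le _ _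
      _ ≤ _ := by rw [norm_one]; linarith
  have hb3 : ‖(q / (2 * (t + 1)) + p + u * q) / D‖ ≤ (3 * ‖p‖ + 2) / t ^ 3 := by
    have hp0 := norm_nonneg p
    have c1 : ‖q / (2 * ((t : ℂ) + 1))‖ ≤ ‖p‖ + 1 := by
      have : (2 * ((t : ℂ) + 1)) = ((2 * (t + 1) : ℝ) : ℂ) := by push_cast; rfl
      rw [this, norm_div, Complex.norm_real, Real.norm_of_nonneg (by positivity),
        div_le_iff₀ (by positivity)]
      nlinarith
    have c2 : ‖u * q‖ ≤ ‖p‖ + 1 := by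
      rw [norm_mul]
      calc _ ≤ 1 / (2 * t ^ 2) * (‖p‖ + t / 2) := by gcongr
        _ ≤ _ := by
          rw [one_div_mul_eq_div, div_le_iff₀ (by positivity)]
          nlinarith [mul_le_mul_of_nonneg_left (one_le_pow₀ ht1 : 1 ≤ t ^ 2) hp0]
    rw [norm_div]
    have c3 := norm_add₃_le (a := q / (2 * ((t : ℂ) + 1))) (b := p) (c := u * q)
    gcongr
    linarith
  calc _ ≤ ‖Complex.exp u - 1 - u‖ * ‖1 + q / D‖ + _ :=
        (norm_add_le _ _).trans (by rw [norm_mul])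
    _ ≤ 1 / t ^ 3 / 2 * (‖p‖ + 2) + (3 * ‖p‖ + 2) / t ^ 3 := by gcongr
    _ = (7 / 2 * ‖p‖ + 3) / t ^ 3 := by
      field_simp
      ring
    _ ≤ _ := by
      gcongr <;> norm_num

open Filter Topology in
theorem summable_sub_of_norm_sub_le {f : ℕ → ℂ} {l : ℂ} {C : ℝ}
    (hl : Tendsto f atTop (𝓝 l)) (hf : ∀ n, ‖f (n + 1) - f n‖ ≤ C / ((n : ℝ) + 1) ^ 3) :
    Summable fun n => f n - l := by
  have hC : 0 ≤ C := by simpa using (norm_nonneg _).trans (hf 0)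
  have hstep : ∀ n : ℕ, C / ((n : ℝ) + 1) ^ 3 ≤
      2 * C * (1 / ((n : ℝ) + 1) ^ 2 - 1 / ((n : ℝ) + 2) ^ 2) := fun n => by
    have : (0 : ℝ) ≤ n := n.cast_nonneg
    rw [div_sub_div _ _ (by positivity) (by positivity), ← mul_div_assoc,
      div_le_div_iff₀ (by positivity) (by positivity)]
    have : ((n : ℝ) + 1) ^ 2 * (n + 2) ^ 2 ≤
        2 * (1 * (n + 2) ^ 2 - (n + 1) ^ 2 * 1) * (n + 1) ^ 3 := by
      have : ((n : ℝ) + 2) ^ 2 ≤ 2 * (1 * (n + 2) ^ 2 - (n + 1) ^ 2 * 1) * (n + 1) := by nlinarith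
      calc _ ≤ ((n : ℝ) + 1) ^ 2 * (2 * (1 * (n + 2) ^ 2 - (n + 1) ^ 2 * 1) * (n + 1)) := by gcongr
        _ = _ := by ring
    calc _ ≤ C * (2 * (1 * ((n : ℝ) + 2) ^ 2 - (n + 1) ^ 2 * 1) * (n + 1) ^ 3) := by gcongr
      _ = _ := by ring
  have hbound : ∀ n m : ℕ, ‖f (n + m) - f n‖ ≤
      2 * C * (1 / ((n : ℝ) + 1) ^ 2 - 1 / (((n + m : ℕ) : ℝ) + 1) ^ 2) := fun n m => by
    induction m with
    | zero => simp
    | succ m ih =>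
      have h1 := (hf (n + m)).trans (hstep (n + m))
      have h2 := norm_add_le (f (n + m + 1) - f (n + m)) (f (n + m) - f n)
      rw [sub_add_sub_cancel] at h2
      rw [← add_assoc]
      push_cast at *
      rw [show (n : ℝ) + m + 1 + 1 = n + m + 2 by ring]
      linarith
  have hfinal : ∀ n : ℕ, ‖f n - l‖ ≤ 2 * C * (1 / ((n : ℝ) + 1) ^ 2) := fun n => by
    rw [norm_sub_rev]
    have h : Tendsto (fun m => ‖f (n + m) - f n‖) atTop (𝓝 ‖l - f n‖) :=
      ((hl.comp (tendsto_add_atTop_nat n)).congr (fun m => by simp [add_comm])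
        |>.sub_const _).norm
    refine le_of_tendsto h (.of_forall fun m => (hbound n m).trans ?_)
    gcongr
    simp only [sub_le_self_iff]
    positivity
  refine Summable.of_norm_bounded (Summable.mul_left _ ?_) hfinal
  have := (summable_nat_add_iff 1).mpr (Real.summable_one_div_nat_pow.mpr one_lt_two)
  simpa using this

theorem multipliable_dressingFactor {x : ℂ} (hx : x.re = 0) :
    Multipliable (dressingFactor x) := by
  have hlim := tendsto_dressingFactor hx
  obtain ⟨M, hM⟩ := hlim.norm.bddAbove_range
  have hM' : ∀ n, ‖dressingFactor x n‖ ≤ M := fun n => hM ⟨n, rfl⟩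
  have hM0 : 0 ≤ M := (norm_nonneg _).trans (hM' 0)
  have hs := summable_sub_of_norm_sub_le (C := M * (4 * ‖x / 2 - x ^ 2‖ + 4)) hlim fun n => by
    rw [dressingFactor_succ hx, ← mul_sub_one, norm_mul, mul_div_assoc M]
    exact mul_le_mul (hM' n) (norm_dressingFactor_ratio_sub_one_le hx n) (norm_nonneg _) hM0
  simpa using Complex.multipliable_one_add_of_summable hs

theorem dressingFactor_mul_neg {x : ℂ} (hx : x.re = 0) (j : ℕ) :
    dressingFactor x j * dressingFactor (-x) j =
      Complex.exp (-((j : ℂ) + 1)⁻¹) * (j + 1) ^ 2 / ((1 / 2 + x + j) * (1 / 2 - x + j)) := by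
  have hre : ∀ (c : ℝ) (y : ℂ), 0 < c → y.re = 0 → 0 < ((j : ℂ) + c + y).re := fun c y hc hy => by
    simp only [Complex.add_re, Complex.natCast_re, Complex.ofReal_re, hy]
    positivity
  have hxn : (-x).re = 0 := by simp [hx]
  have r1 := hre (1 / 2) x (by norm_num) hx
  have r2 := hre (1 / 2) (-x) (by norm_num) hxn
  have r3 := hre 1 x (by norm_num) hx
  have r4 := hre 1 (-x) (by norm_num) hxn
  have k0 : (j : ℂ) + 1 ≠ 0 := by exact_mod_cast (by omega : j + 1 ≠ 0)
  have e1 : (j : ℂ) + (1 / 2 : ℝ) + x = 1 / 2 + x + j := by push_cast; ring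
  have e2 : (j : ℂ) + (1 / 2 : ℝ) + -x = 1 / 2 - x + j := by push_cast; ring
  have e3 : (j : ℂ) + (1 : ℝ) + x = j + 1 + x := by push_cast; ring
  have e4 : (j : ℂ) + (1 : ℝ) + -x = j + 1 - x := by push_cast; ring
  rw [e1] at r1
  rw [e2] at r2
  rw [e3] at r3
  rw [e4] at r4
  have ne0 : ∀ {z : ℂ}, 0 < z.re → z ≠ 0 := fun h h0 => by simp [h0] at h
  have g1 := Complex.Gamma_ne_zero_of_re_pos r1
  have g2 := Complex.Gamma_ne_zero_of_re_pos r2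
  have g3 := Complex.Gamma_ne_zero_of_re_pos r3
  have g4 := Complex.Gamma_ne_zero_of_re_pos r4
  have n1 := ne0 r1
  have n2 := ne0 r2
  have hexp : Complex.exp (-((j : ℂ) + 1)⁻¹) = Complex.exp (-(1 / (2 * ((j : ℂ) + 1)))) ^ 2 := by
    rw [← Complex.exp_nat_mul]
    congr 1
    push_cast
    field_simp
  rw [dressingFactor, dressingFactor, hexp, sub_neg_eq_add, sub_neg_eq_add, ← sub_eq_add_neg,
    ← sub_eq_add_neg,
    show (j : ℂ) + 1 - 1 / 2 + x = 1 / 2 + x + j by ring,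
    show (j : ℂ) + 1 - 1 / 2 - x = 1 / 2 - x + j by ring,
    show (j : ℂ) + 1 + 1 / 2 - x = (1 / 2 - x + j) + 1 by ring,
    show (j : ℂ) + 1 + 1 / 2 + x = (1 / 2 + x + j) + 1 by ring,
    Complex.Gamma_add_one _ n1, Complex.Gamma_add_one _ n2]
  generalize Complex.Gamma (1 / 2 + x + j) = a at *
  generalize Complex.Gamma (1 / 2 - x + j) = b at *
  generalize Complex.Gamma (j + 1 + x) = c at *
  generalize Complex.Gamma (j + 1 - x) = d at *
  generalize 1 / 2 + x + (j : ℂ) = v at *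
  generalize 1 / 2 - x + (j : ℂ) = w at *
  generalize Complex.exp (-(1 / (2 * ((j : ℂ) + 1)))) = e at *
  field_simp

open scoped Nat in
theorem prod_dressingFactor_mul_neg {x : ℂ} (hx : x.re = 0) {n : ℕ} (hn : n ≠ 0) :
    ∏ j ∈ Finset.range (n + 1), (dressingFactor x j * dressingFactor (-x) j) =
      Complex.exp (-((harmonic (n + 1) - Real.log ((n + 1 : ℕ) : ℝ) : ℝ) : ℂ)) * (1 + (n : ℂ)⁻¹) *
        (Complex.GammaSeq (1 / 2 + x) n * Complex.GammaSeq (1 / 2 - x) n) := by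
  have hn' : (n : ℂ) ≠ 0 := Nat.cast_ne_zero.mpr hn
  have hn1 : (n : ℂ) + 1 ≠ 0 := by exact_mod_cast n.succ_ne_zero
  simp only [dressingFactor_mul_neg hx, Finset.prod_div_distrib, Finset.prod_mul_distrib,
    ← Complex.exp_sum, Finset.prod_pow]
  have hfact : ∏ j ∈ Finset.range (n + 1), ((j : ℂ) + 1) = ((n : ℂ) + 1) * (n ! : ℂ) := by
    have := Finset.prod_range_add_one_eq_factorial (n + 1)
    rw [Nat.factorial_succ] at this
    exact_mod_cast this
  have hpow : (n : ℂ) ^ (1 / 2 + x) * (n : ℂ) ^ (1 / 2 - x) = n := by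
    rw [← Complex.cpow_add _ _ hn']
    ring_nf
    exact Complex.cpow_one _
  have hexp : Complex.exp (-((harmonic (n + 1) - Real.log ((n + 1 : ℕ) : ℝ) : ℝ) : ℂ)) =
      Complex.exp (∑ j ∈ Finset.range (n + 1), -((j : ℂ) + 1)⁻¹) * (n + 1) := by
    rw [← Complex.ofReal_neg, ← Complex.ofReal_exp, neg_sub, sub_eq_neg_add, Real.exp_add,
      Real.exp_log (by positivity), harmonic]
    push_cast
    simp
  rw [hexp, hfact, Complex.GammaSeq, Complex.GammaSeq, div_mul_div_comm, mul_mul_mul_comm, hpow]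
  field_simp

open Filter Topology in
theorem tprod_dressingFactor_mul_neg {x : ℂ} (hx : x.re = 0) :
    (∏' j, dressingFactor x j) * ∏' j, dressingFactor (-x) j =
      Complex.exp (-(Real.eulerMascheroniConstant : ℂ)) * (Real.pi / Complex.cos (Real.pi * x)) := by
  have hxn : (-x).re = 0 := by simp [hx]
  have m1 := multipliable_dressingFactor hx
  have m2 := multipliable_dressingFactor hxn
  rw [← m1.tprod_mul m2]
  have hlim := (m1.mul m2).hasProd.tendsto_prod_nat.comp (tendsto_add_atTop_nat 1)
  refine tendsto_nhds_unique hlim ?_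
  have hγ : Tendsto (fun n : ℕ => Complex.exp
      (-((harmonic (n + 1) - Real.log ((n + 1 : ℕ) : ℝ) : ℝ) : ℂ))) atTop
      (𝓝 (Complex.exp (-(Real.eulerMascheroniConstant : ℂ)))) := by
    have h := Real.tendsto_harmonic_sub_log.comp (tendsto_add_atTop_nat 1)
    exact (Complex.continuous_exp.tendsto _).comp
      ((Complex.continuous_ofReal.tendsto _).comp h).neg
  have hq : Tendsto (fun n : ℕ => 1 + ((n : ℂ))⁻¹) atTop (𝓝 1) := by
    simpa using (tendsto_inv_atTop_nhds_zero_nat (𝕜 := ℂ)).const_add 1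
  have hG := (Complex.GammaSeq_tendsto_Gamma (1 / 2 + x)).mul
    (Complex.GammaSeq_tendsto_Gamma (1 / 2 - x))
  have href : Complex.Gamma (1 / 2 + x) * Complex.Gamma (1 / 2 - x) =
      Real.pi / Complex.cos (Real.pi * x) := by
    have := Complex.Gamma_mul_Gamma_one_sub (1 / 2 + x)
    rw [show 1 - (1 / 2 + x) = 1 / 2 - x by ring,
      show Real.pi * (1 / 2 + x) = Real.pi * x + Real.pi / 2 by ring,
      Complex.sin_add_pi_div_two] at this
    exact this
  rw [href] at hG
  have h := (hγ.mul hq).mul hG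
  rw [mul_one] at h
  refine h.congr' ?_
  filter_upwards [eventually_ne_atTop 0] with n hn
  exact (prod_dressingFactor_mul_neg hx hn).symm

/-- For every real `θ` the infinite product defining the dressing factor `Ω` converges, and
`Ω(θ) Ω(-θ) = e^{-iπ/4} / (2 cosh (θ/2))`. -/
theorem OmegaAdS2_braiding (θ : ℝ) :
    (Multipliable fun j : ℕ =>
      Complex.exp (-(1 / (2 * ((j : ℂ) + 1)))) * ((j : ℂ) + 1) *
        (Complex.Gamma ((j : ℂ) + 1 - 1 / 2 + (θ : ℂ) / (2 * Real.pi * Complex.I)) *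
            Complex.Gamma ((j : ℂ) + 1 - (θ : ℂ) / (2 * Real.pi * Complex.I)) /
          (Complex.Gamma ((j : ℂ) + 1 + 1 / 2 - (θ : ℂ) / (2 * Real.pi * Complex.I)) *
            Complex.Gamma ((j : ℂ) + 1 + (θ : ℂ) / (2 * Real.pi * Complex.I))))) ∧
    OmegaAdS2 θ * OmegaAdS2 (-θ) =
      Complex.exp (-(Real.pi : ℂ) * Complex.I / 4) / (2 * Complex.cosh ((θ : ℂ) / 2)) := by
  have hx : ((θ : ℂ) / (2 * Real.pi * Complex.I)).re = 0 := by
    simp [Complex.div_re]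
  refine ⟨multipliable_dressingFactor hx, ?_⟩
  have hΩ : ∀ t : ℝ, OmegaAdS2 t =
      (Complex.exp ((Real.eulerMascheroniConstant : ℂ) / 2 - Real.pi * Complex.I / 8 + (t : ℂ) / 4)
        / (Real.sqrt (2 * Real.pi) : ℂ)) *
      ∏' j, dressingFactor ((t : ℂ) / (2 * Real.pi * Complex.I)) j := fun _ => rfl
  have hpi : (Real.pi : ℂ) ≠ 0 := Complex.ofReal_ne_zero.mpr Real.pi_ne_zero
  have hcos : Complex.cos (Real.pi * ((θ : ℂ) / (2 * Real.pi * Complex.I))) =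
      Complex.cosh ((θ : ℂ) / 2) := by
    rw [← Complex.cos_mul_I, ← Complex.cos_neg]
    congr 1
    field_simp
    simp
  have hsqrt : (Real.sqrt (2 * Real.pi) : ℂ) * (Real.sqrt (2 * Real.pi) : ℂ) = 2 * Real.pi := by
    rw [← Complex.ofReal_mul, Real.mul_self_sqrt (by positivity)]
    push_cast
    rfl
  rw [hΩ, hΩ, Complex.ofReal_neg, neg_div (2 * Real.pi * Complex.I), mul_mul_mul_comm,
    tprod_dressingFactor_mul_neg hx, hcos, div_mul_div_comm, hsqrt, ← Complex.exp_add,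
    div_mul_eq_mul_div, ← mul_assoc, ← Complex.exp_add,
    show (Real.eulerMascheroniConstant : ℂ) / 2 - Real.pi * Complex.I / 8 + (θ : ℂ) / 4 +
      ((Real.eulerMascheroniConstant : ℂ) / 2 - Real.pi * Complex.I / 8 + -(θ : ℂ) / 4) +
      -(Real.eulerMascheroniConstant : ℂ) = -(Real.pi : ℂ) * Complex.I / 4 by ring]
  field_simp
end

section
/- For real θ, let R(θ) be the 4×4 matrix with nonzero entries R₁₁ = 1, R₂₂ = −tanh(θ/2), R₂₃ = R₃₂ = sech(θ/2), R₃₃ = tanh(θ/2), R₄₄ = −1, and let Y be the 4×4 matrix whose only nonzero entries are Y₂₃ = −1 and Y₃₂ = 1. Then R satisfies the parallel (flatness) equation R'(θ) = (1/(2 cosh(θ/2))) · Y · R(θ) for all θ ∈ ℝ; equivalently (d/dθ + Γ_θ)R(θ) = 0 with connection Γ_θ = −Y/(2 cosh(θ/2)). Consequently R(θ) is the path-ordered exponential of this connection times R(0), which is the permutation-type matrix R(0) with entries R₁₁ = 1, R₂₃ = R₃₂ = 1, R₄₄ = −1. -/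
open Real

attribute [local instance] Matrix.normedAddCommGroup Matrix.normedSpace

/-- The relativistic massless R-matrix of the `AdS₃ × S³ × T⁴` superstring. -/
noncomputable def RmatrixAdS3rel (θ : ℝ) : Matrix (Fin 4) (Fin 4) ℝ :=
  !![1, 0, 0, 0;
     0, -Real.tanh (θ / 2), 1 / Real.cosh (θ / 2), 0;
     0, 1 / Real.cosh (θ / 2), Real.tanh (θ / 2), 0;
     0, 0, 0, -1]

/-- The matrix `Y = E₁₂ ⊗ E₂₁ + E₂₁ ⊗ E₁₂` in the graded tensor-product conventions,
realized on `ℂ² ⊗ ℂ² ≅ ℂ⁴`. -/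
def YmatrixAdS3 : Matrix (Fin 4) (Fin 4) ℝ :=
  !![0, 0, 0, 0;
     0, 0, -1, 0;
     0, 1, 0, 0;
     0, 0, 0, 0]

theorem Real.hasDerivAt_tanh_half (θ : ℝ) :
    HasDerivAt (fun t => Real.tanh (t / 2)) (1 / (2 * Real.cosh (θ / 2) ^ 2)) θ := by
  have hc : Real.cosh (θ / 2) ≠ 0 := (Real.cosh_pos _).ne'
  have hd : HasDerivAt (fun t : ℝ => t / 2) (1 / 2) θ := (hasDerivAt_id θ).div_const 2
  simp only [Real.tanh_eq_sinh_div_cosh]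
  refine (hd.sinh.div hd.cosh hc).congr_deriv ?_
  field_simp
  linear_combination Real.cosh_sq (θ / 2)

theorem Real.hasDerivAt_sech_half (θ : ℝ) :
    HasDerivAt (fun t => 1 / Real.cosh (t / 2))
      (-(Real.sinh (θ / 2) / (2 * Real.cosh (θ / 2) ^ 2))) θ := by
  have hc : Real.cosh (θ / 2) ≠ 0 := (Real.cosh_pos _).ne'
  have hd : HasDerivAt (fun t : ℝ => t / 2) (1 / 2) θ := (hasDerivAt_id θ).div_const 2
  simp only [one_div]
  refine (hd.cosh.inv hc).congr_deriv ?_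
  field_simp

/-- The relativistic massless `AdS₃` R-matrix satisfies the parallel (flatness) equation
`R'(θ) = (1/(2 cosh (θ/2))) • (Y * R(θ))`, i.e. `(d/dθ + Γ_θ) R = 0` with
`Γ_θ = -Y / (2 cosh (θ/2))`; moreover `R(0)` is the permutation-type matrix with entries
`R₁₁ = 1`, `R₂₃ = R₃₂ = 1`, `R₄₄ = -1`. -/
theorem RmatrixAdS3rel_parallel :
    (∀ θ : ℝ, HasDerivAt RmatrixAdS3rel
      ((1 / (2 * Real.cosh (θ / 2))) • (YmatrixAdS3 * RmatrixAdS3rel θ)) θ) ∧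
    RmatrixAdS3rel 0 = !![1, 0, 0, 0;
                          0, 0, 1, 0;
                          0, 1, 0, 0;
                          0, 0, 0, -1] := by
  refine ⟨fun θ => ?_, by simp [RmatrixAdS3rel]⟩
  have ht := Real.hasDerivAt_tanh_half θ
  have hs := Real.hasDerivAt_sech_half θ
  have hc : Real.cosh (θ / 2) ≠ 0 := (Real.cosh_pos _).ne'
  refine hasDerivAt_pi.2 fun i => hasDerivAt_pi.2 fun j => ?_
  fin_cases i <;> fin_cases j <;>
    simp only [RmatrixAdS3rel, YmatrixAdS3, Matrix.smul_apply, Matrix.mul_apply, Fin.sum_univ_four,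
      Matrix.of_apply, Matrix.cons_val, Fin.mk_zero, Fin.mk_one, Fin.reduceFinMk, Fin.isValue,
      smul_eq_mul, zero_mul, mul_zero, add_zero, zero_add, one_mul, neg_mul]
  all_goals first
    | exact (hasDerivAt_const θ _).congr_deriv (by simp)
    | exact ht.congr_deriv (by field_simp)
    | exact ht.neg.congr_deriv (by field_simp)
    | exact hs.congr_deriv (by rw [Real.tanh_eq_sinh_div_cosh]; field_simp)
end

section
/- For (p₁, p₂) ∈ (0,π)², set γᵢ = log(tan(pᵢ/4)), γ = γ₁ − γ₂, and let R(p₁,p₂) be the 4×4 matrix with nonzero entries R₁₁ = 1, R₂₂ = −tanh(γ/2), R₂₃ = R₃₂ = sech(γ/2), R₃₃ = tanh(γ/2), R₄₄ = −1, and let Y be the 4×4 matrix whose only nonzero entries are Y₂₃ = −1, Y₃₂ = 1. Then R satisfies the two parallel equations ∂R/∂p₁ + Γ₁·R = 0 and ∂R/∂p₂ + Γ₂·R = 0, where Γ₁ = −(1/4)·√(sin(p₂/2)/sin(p₁/2))·Y / sin((p₁+p₂)/4) and Γ₂ = (1/4)·√(sin(p₁/2)/sin(p₂/2))·Y / sin((p₁+p₂)/4).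 (A key ingredient is the identity cosh(γ/2) = sin((p₁+p₂)/4)/√(sin(p₁/2)·sin(p₂/2)) for p₁, p₂ ∈ (0,π).) -/
open Real

attribute [local instance] Matrix.normedAddCommGroup Matrix.normedSpace

/-- The non-relativistic rapidity `γ = log (tan (p/4))`. -/
noncomputable def rapidityAdS3 (p : ℝ) : ℝ := Real.log (Real.tan (p / 4))

/-- The non-relativistic massless R-matrix of the `AdS₃ × S³ × T⁴` superstring, written in
terms of `γ = γ₁ - γ₂` with `γᵢ = log (tan (pᵢ/4))`. -/
noncomputable def RmatrixAdS3 (q : ℝ × ℝ) : Matrix (Fin 4) (Fin 4) ℝ :=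
  let γ : ℝ := rapidityAdS3 q.1 - rapidityAdS3 q.2
  !![1, 0, 0, 0;
     0, -Real.tanh (γ / 2), 1 / Real.cosh (γ / 2), 0;
     0, 1 / Real.cosh (γ / 2), Real.tanh (γ / 2), 0;
     0, 0, 0, -1]

/-- The component `Γ₁` of the flat connection. -/
noncomputable def GammaOneAdS3 (p₁ p₂ : ℝ) : Matrix (Fin 4) (Fin 4) ℝ :=
  (-(1 / 4) * Real.sqrt (Real.sin (p₂ / 2) / Real.sin (p₁ / 2)) /
    Real.sin ((p₁ + p₂) / 4)) • YmatrixAdS3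

/-- The component `Γ₂` of the flat connection. -/
noncomputable def GammaTwoAdS3 (p₁ p₂ : ℝ) : Matrix (Fin 4) (Fin 4) ℝ :=
  ((1 / 4) * Real.sqrt (Real.sin (p₁ / 2) / Real.sin (p₂ / 2)) /
    Real.sin ((p₁ + p₂) / 4)) • YmatrixAdS3

/-- `cosh (γ/2) = sin ((p₁+p₂)/4) / √(sin (p₁/2) sin (p₂/2))` on `(0, π)²`. -/
theorem cosh_half_rapidityAdS3_sub {p₁ p₂ : ℝ} (h₁ : p₁ ∈ Set.Ioo 0 π)
    (h₂ : p₂ ∈ Set.Ioo 0 π) :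
    Real.cosh ((rapidityAdS3 p₁ - rapidityAdS3 p₂) / 2) =
      Real.sin ((p₁ + p₂) / 4) / Real.sqrt (Real.sin (p₁ / 2) * Real.sin (p₂ / 2)) := by
  obtain ⟨hp₁, hp₁π⟩ := h₁
  obtain ⟨hp₂, hp₂π⟩ := h₂
  have hs₁ : 0 < sin (p₁ / 4) := sin_pos_of_pos_of_lt_pi (by linarith) (by linarith)
  have hs₂ : 0 < sin (p₂ / 4) := sin_pos_of_pos_of_lt_pi (by linarith) (by linarith)
  have hc₁ : 0 < cos (p₁ / 4) := cos_pos_of_mem_Ioo ⟨by linarith, by linarith⟩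
  have hc₂ : 0 < cos (p₂ / 4) := cos_pos_of_mem_Ioo ⟨by linarith, by linarith⟩
  have hsum : 0 < sin ((p₁ + p₂) / 4) :=
    sin_pos_of_pos_of_lt_pi (by linarith) (by linarith)
  have ht₁ : 0 < tan (p₁ / 4) := by rw [tan_eq_sin_div_cos]; positivity
  have ht₂ : 0 < tan (p₂ / 4) := by rw [tan_eq_sin_div_cos]; positivity
  have hd₁ : sin (p₁ / 2) = 2 * sin (p₁ / 4) * cos (p₁ / 4) := by
    rw [← sin_two_mul]; congr 1; ring
  have hd₂ : sin (p₂ / 2) = 2 * sin (p₂ / 4) * cos (p₂ / 4) := by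
    rw [← sin_two_mul]; congr 1; ring
  have hadd : sin ((p₁ + p₂) / 4) =
      sin (p₁ / 4) * cos (p₂ / 4) + cos (p₁ / 4) * sin (p₂ / 4) := by
    rw [← sin_add]; congr 1; ring
  have hcosh : cosh (rapidityAdS3 p₁ - rapidityAdS3 p₂) =
      (tan (p₁ / 4) / tan (p₂ / 4) + (tan (p₁ / 4) / tan (p₂ / 4))⁻¹) / 2 := by
    rw [rapidityAdS3, rapidityAdS3, ← log_div ht₁.ne' ht₂.ne', cosh_log (div_pos ht₁ ht₂)]
  have hsq : cosh ((rapidityAdS3 p₁ - rapidityAdS3 p₂) / 2) ^ 2 =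
      (cosh (rapidityAdS3 p₁ - rapidityAdS3 p₂) + 1) / 2 := by
    have h := cosh_two_mul ((rapidityAdS3 p₁ - rapidityAdS3 p₂) / 2)
    rw [mul_div_cancel₀ _ two_ne_zero, sinh_sq] at h
    linarith
  rw [← sq_eq_sq₀ (cosh_pos _).le (by positivity), hsq, hcosh, div_pow,
    sq_sqrt (by rw [hd₁, hd₂]; positivity), hadd, hd₁, hd₂, tan_eq_sin_div_cos,
    tan_eq_sin_div_cos]
  field_simp
  ring

theorem hasDerivAt_rapidityAdS3 {p : ℝ} (h : p ∈ Set.Ioo 0 π) :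
    HasDerivAt rapidityAdS3 (1 / (2 * sin (p / 2))) p := by
  obtain ⟨hp, hpπ⟩ := h
  have hs : 0 < sin (p / 4) := sin_pos_of_pos_of_lt_pi (by linarith) (by linarith)
  have hc : 0 < cos (p / 4) := cos_pos_of_mem_Ioo ⟨by linarith, by linarith⟩
  have ht : tan (p / 4) ≠ 0 := by rw [tan_eq_sin_div_cos]; positivity
  have hd : sin (p / 2) = 2 * sin (p / 4) * cos (p / 4) := by
    rw [← sin_two_mul]; congr 1; ring
  have key : HasDerivAt (fun q => tan (q / 4)) (1 / cos (p / 4) ^ 2 * (1 / 4)) p :=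
    HasDerivAt.comp (h := fun q => q / 4) (h₂ := tan) p (hasDerivAt_tan hc.ne')
      ((hasDerivAt_id' p).div_const 4)
  refine (key.log ht).congr_deriv ?_
  rw [hd, tan_eq_sin_div_cos]
  field_simp
  norm_num

theorem hasDerivAt_one_div_cosh (x : ℝ) :
    HasDerivAt (fun y => 1 / cosh y) (-(tanh x / cosh x)) x := by
  have hc := (cosh_pos x).ne'
  refine ((hasDerivAt_const x (1 : ℝ)).fun_div (hasDerivAt_cosh x) hc).congr_deriv ?_
  rw [tanh_eq_sinh_div_cosh]
  field_simp
  ring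

theorem hasDerivAt_tanh_one_div_cosh_sq (x : ℝ) :
    HasDerivAt tanh (1 / cosh x ^ 2) x := by
  have hc := (cosh_pos x).ne'
  have h := (hasDerivAt_sinh x).fun_div (hasDerivAt_cosh x) hc
  rw [← funext tanh_eq_sinh_div_cosh] at h
  refine h.congr_deriv ?_
  rw [← cosh_sq_sub_sinh_sq x]
  ring

/-- The derivative of the R-matrix in the direction `v` is a multiple of `Y * R`. -/
theorem RmatrixAdS3_fderiv {p₁ p₂ : ℝ} (h₁ : p₁ ∈ Set.Ioo 0 π) (h₂ : p₂ ∈ Set.Ioo 0 π) :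
    DifferentiableAt ℝ RmatrixAdS3 (p₁, p₂) ∧
    ∀ v : ℝ × ℝ, fderiv ℝ RmatrixAdS3 (p₁, p₂) v =
      ((v.1 / (4 * sin (p₁ / 2)) - v.2 / (4 * sin (p₂ / 2))) /
        cosh ((rapidityAdS3 p₁ - rapidityAdS3 p₂) / 2)) •
        (YmatrixAdS3 * RmatrixAdS3 (p₁, p₂)) := by
  have hg₁ := HasDerivAt.comp_hasFDerivAt (f := Prod.fst) (h₂ := rapidityAdS3) (p₁, p₂)
    (hasDerivAt_rapidityAdS3 h₁) (hasFDerivAt_fst (𝕜 := ℝ))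
  have hg₂ := HasDerivAt.comp_hasFDerivAt (f := Prod.snd) (h₂ := rapidityAdS3) (p₁, p₂)
    (hasDerivAt_rapidityAdS3 h₂) (hasFDerivAt_snd (𝕜 := ℝ))
  have hg := (hg₁.sub hg₂).mul_const (1 / 2)
  have ht := (hasDerivAt_tanh_one_div_cosh_sq _).comp_hasFDerivAt (p₁, p₂) hg
  have hc := (hasDerivAt_one_div_cosh _).comp_hasFDerivAt (p₁, p₂) hg
  have hR := ((ht.smul_const
      (!![0, 0, 0, 0; 0, -1, 0, 0; 0, 0, 1, 0; 0, 0, 0, 0] : Matrix (Fin 4) (Fin 4) ℝ)).add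
    (hc.smul_const
      (!![0, 0, 0, 0; 0, 0, 1, 0; 0, 1, 0, 0; 0, 0, 0, 0] : Matrix (Fin 4) (Fin 4) ℝ))).add_const
    (!![1, 0, 0, 0; 0, 0, 0, 0; 0, 0, 0, 0; 0, 0, 0, -1] : Matrix (Fin 4) (Fin 4) ℝ)
  replace hR := hR.congr_of_eventuallyEq (f₁ := RmatrixAdS3) (.of_forall fun q => by
    ext i j
    fin_cases i <;> fin_cases j <;> simp [RmatrixAdS3, div_eq_mul_inv])
  refine ⟨hR.differentiableAt, fun v => ?_⟩
  refine (DFunLike.congr_fun hR.fderiv v).trans ?_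
  ext i j
  fin_cases i <;> fin_cases j <;>
    simp [RmatrixAdS3, YmatrixAdS3] <;> ring_nf

/-- The coefficient of the connection, expressed through `cosh (γ/2)`. -/
theorem sqrt_div_div_eq {a b c d : ℝ} (ha : 0 < a) (hb : 0 < b) (hd : d = c / √(a * b)) :
    √(b / a) / c = 1 / (a * d) := by
  have h : √(b / a) = √(a * b) / a := by
    rw [show b / a = a * b / a ^ 2 by field_simp, sqrt_div (by positivity), sqrt_sq ha.le]
  rw [h, hd]
  field_simp

/-- The non-relativistic massless `AdS₃` R-matrix satisfies the two parallel equations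
`∂R/∂p₁ + Γ₁ R = 0` and `∂R/∂p₂ + Γ₂ R = 0`; a key ingredient is the identity
`cosh (γ/2) = sin ((p₁+p₂)/4) / √(sin (p₁/2) sin (p₂/2))` for `p₁, p₂ ∈ (0, π)`. -/
theorem RmatrixAdS3_parallel (p₁ p₂ : ℝ) (h₁ : p₁ ∈ Set.Ioo 0 π) (h₂ : p₂ ∈ Set.Ioo 0 π) :
    DifferentiableAt ℝ RmatrixAdS3 (p₁, p₂) ∧
    fderiv ℝ RmatrixAdS3 (p₁, p₂) (1, 0) + GammaOneAdS3 p₁ p₂ * RmatrixAdS3 (p₁, p₂) = 0 ∧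
    fderiv ℝ RmatrixAdS3 (p₁, p₂) (0, 1) + GammaTwoAdS3 p₁ p₂ * RmatrixAdS3 (p₁, p₂) = 0 ∧
    Real.cosh ((rapidityAdS3 p₁ - rapidityAdS3 p₂) / 2) =
      Real.sin ((p₁ + p₂) / 4) / Real.sqrt (Real.sin (p₁ / 2) * Real.sin (p₂ / 2)) := by
  obtain ⟨hR, hD⟩ := RmatrixAdS3_fderiv h₁ h₂
  have hcosh := cosh_half_rapidityAdS3_sub h₁ h₂
  have hs₁ : 0 < sin (p₁ / 2) :=
    sin_pos_of_pos_of_lt_pi (by linarith [h₁.1]) (by linarith [h₁.1, h₁.2])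
  have hs₂ : 0 < sin (p₂ / 2) :=
    sin_pos_of_pos_of_lt_pi (by linarith [h₂.1]) (by linarith [h₂.1, h₂.2])
  have hcosh' := hcosh
  rw [mul_comm (sin (p₁ / 2))] at hcosh'
  refine ⟨hR, ?_, ?_, hcosh⟩
  · rw [hD, GammaOneAdS3, smul_mul_assoc, ← add_smul, mul_div_assoc,
      sqrt_div_div_eq hs₁ hs₂ hcosh]
    convert zero_smul ℝ _ using 2
    field_simp
    ring
  · rw [hD, GammaTwoAdS3, smul_mul_assoc, ← add_smul, mul_div_assoc,
      sqrt_div_div_eq hs₂ hs₁ hcosh']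
    convert zero_smul ℝ _ using 2
    field_simp
    ring
end
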